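/- Let k be an algebraically closed field of characteristic zero and let X be a proper variety over k that has an arithmetically-pure model. Then X has no rational curves, i.e., every morphism ℙ¹_k → X is constant. -/

import Mathlib

/-!
Formalization of a statement from "The Lang–Vojta conjectures on projective
pseudo-hyperbolic varieties" (Javanpeykar).

Notions not available in Mathlib (analytifications, genus, ample degrees, Hom-schemes, ...)
are encoded by explicit definitions or structures below; see the docstrings for the
conventions used.
-/

open CategoryTheory AlgebraicGeometry Limits

noncomputable section

/-- `Spec R` as a scheme, for a commutative ring `R`. -/
abbrev SR (R : Type) [CommRing R] : Scheme := Spec (CommRingCat.of R)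

/-- The category of schemes over `Spec R`. -/
abbrev OverR (R : Type) [CommRing R] := Over (SR R)

/-- A morphism of schemes over `Spec R` is constant if it factors through the base `Spec R`. -/
def IsConstant {R : Type} [CommRing R] {X Y : OverR R} (f : X ⟶ Y) : Prop :=
  ∃ y : SR R ⟶ Y.left, f.left = X.hom ≫ y

/-- A morphism `g : V ⟶ W` of schemes, where `V` has structure morphism `sV` to `Spec R`,
is constant if it factors through `Spec R`. -/
def IsConstantHom {R : Type} [CommRing R] {V W : Scheme} (sV : V ⟶ SR R) (g : V ⟶ W) : Prop :=
  ∃ y : SR R ⟶ W, g = sV ≫ y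

/-- A variety over `R`: a finite type, separated scheme over `Spec R`. -/
def IsVarietyOver {R : Type} [CommRing R] (X : OverR R) : Prop :=
  LocallyOfFiniteType X.hom ∧ QuasiCompact X.hom ∧ IsSeparated X.hom

/-- The multiplicative group scheme `𝔾ₘ` over `R`, i.e. the spectrum of the Laurent
polynomial ring over `R` (only its underlying scheme over `Spec R` is needed). -/
def GmO (R : Type) [CommRing R] : OverR R :=
  Over.mk (Spec.map (CommRingCat.ofHom (algebraMap R (LaurentPolynomial R))))

/-- The affine line over `R`. -/
def A1O (R : Type) [CommRing R] : OverR R :=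
  Over.mk (Spec.map (CommRingCat.ofHom (algebraMap R (Polynomial R))))

/-- `Spec R` as the terminal object of the category of schemes over `Spec R`. -/
def ptO (R : Type) [CommRing R] : OverR R := Over.mk (𝟙 (SR R))

/-- A group scheme over `R`, presented via a group structure on its functor of points:
by the Yoneda lemma this is the same as a group object in the category of schemes
over `Spec R`. -/
structure GroupScheme (R : Type) [CommRing R] where
  G : OverR R
  mul : ∀ {T : OverR R}, (T ⟶ G) → (T ⟶ G) → (T ⟶ G)
  one : ∀ (T : OverR R), T ⟶ G
  inv : ∀ {T : OverR R}, (T ⟶ G) → (T ⟶ G)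
  mul_assoc : ∀ {T : OverR R} (a b c : T ⟶ G), mul (mul a b) c = mul a (mul b c)
  one_mul : ∀ {T : OverR R} (a : T ⟶ G), mul (one T) a = a
  inv_mul : ∀ {T : OverR R} (a : T ⟶ G), mul (inv a) a = one T
  mul_natural : ∀ {T T' : OverR R} (f : T ⟶ T') (a b : T' ⟶ G),
    f ≫ mul a b = mul (f ≫ a) (f ≫ b)
  one_natural : ∀ {T T' : OverR R} (f : T ⟶ T'), f ≫ one T' = one T

/-- A finite type, connected group scheme over `R`. -/
def GroupScheme.IsFiniteTypeConnected {R : Type} [CommRing R] (Γ : GroupScheme R) : Prop :=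
  LocallyOfFiniteType Γ.G.hom ∧ QuasiCompact Γ.G.hom ∧ ConnectedSpace Γ.G.left

/-- An abelian variety over `R`: a connected finite type proper group scheme. (Over an
algebraically closed field of characteristic zero this agrees with the usual definition,
since group schemes are then automatically smooth by Cartier's theorem.) -/
def GroupScheme.IsAbelianVariety {R : Type} [CommRing R] (Γ : GroupScheme R) : Prop :=
  Γ.IsFiniteTypeConnected ∧ IsProper Γ.G.hom

/-- A scheme over `R` is groupless if every morphism to it from `𝔾ₘ` and from any abelian
variety over `R` is constant. -/
def IsGroupless (R : Type) [CommRing R] (X : OverR R) : Prop :=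
  (∀ f : GmO R ⟶ X, IsConstant f) ∧
  (∀ Γ : GroupScheme R, Γ.IsAbelianVariety → ∀ f : Γ.G ⟶ X, IsConstant f)

/-- A subset `Z` of a topological space has codimension at least two: every point of
`Z` admits a chain of two strict generizations (this computes the codimension of the
closure of each point of `Z` via the specialization order). -/
def CodimAtLeastTwo {T : Type} [TopologicalSpace T] (Z : Set T) : Prop :=
  ∀ z ∈ Z, ∃ x y : T, x ⤳ y ∧ y ⤳ z ∧ ¬(y ⤳ x) ∧ ¬(z ⤳ y)

/-- `X` is groupless modulo the closed subset `Δ` if for every finite type connected group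
scheme `G` over `R` and every dense open `U ⊆ G` whose complement has codimension at least
two, every non-constant morphism `U ⟶ X` over `R` factors over `Δ`. -/
def GrouplessModulo (R : Type) [CommRing R] (X : OverR R) (Δ : Set X.left) : Prop :=
  ∀ (Γ : GroupScheme R), Γ.IsFiniteTypeConnected →
    ∀ (U : Γ.G.left.Opens), Dense (U : Set Γ.G.left) →
      CodimAtLeastTwo ((U : Set Γ.G.left)ᶜ) →
      ∀ g : U.toScheme ⟶ X.left, g ≫ X.hom = U.ι ≫ Γ.G.hom →
        ¬ IsConstantHom (U.ι ≫ Γ.G.hom) g → Set.range g.base ⊆ Δ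

/-- `X` is pseudo-groupless if it is groupless modulo some proper closed subset. -/
def PseudoGroupless (R : Type) [CommRing R] (X : OverR R) : Prop :=
  ∃ Δ : Set X.left, IsClosed Δ ∧ Δ ≠ Set.univ ∧ GrouplessModulo R X Δ

/-- The unique point of `Spec k`, for `k` a field. -/
def specPt (k : Type) [Field k] : SR k := (⟨⊥, Ideal.bot_prime⟩ : PrimeSpectrum k)

/-- A model of `X` over a subring `A ⊆ k`: a finite type separated scheme over `Spec A`
together with an identification of its base change to `k` with `X`. -/
structure SchemeModel (k : Type) [Field k] (A : Subring k) (X : OverR k) where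
  M : Scheme
  str : M ⟶ SR ↥A
  lft : LocallyOfFiniteType str
  qc : QuasiCompact str
  sep : IsSeparated str
  base : pullback str (Spec.map (CommRingCat.ofHom A.subtype)) ≅ X.left
  base_w : base.hom ≫ X.hom = pullback.snd str (Spec.map (CommRingCat.ofHom A.subtype))

/-- `x` is the `k`-point of `X` induced (via the base change identification) by the
`k`-valued point `m` of the model. -/
def SchemeModel.InducesPoint {k : Type} [Field k] {A : Subring k} {X : OverR k}
    (𝒳 : SchemeModel k A X) (m : SR k ⟶ 𝒳.M) (x : X.left) : Prop :=
  ∃ q : SR k ⟶ X.left,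
    q ≫ 𝒳.base.inv ≫ pullback.fst 𝒳.str (Spec.map (CommRingCat.ofHom A.subtype)) = m ∧
    q ≫ 𝒳.base.inv ≫ pullback.snd 𝒳.str (Spec.map (CommRingCat.ofHom A.subtype)) = 𝟙 (SR k) ∧
    x = q.base (specPt k)

/-- Every positive-dimensional irreducible component of the closure of `s` is contained
in `Δ`. -/
def ComponentsModulo {X : Scheme} (Δ s : Set X) : Prop :=
  ∀ T : Set X, IsIrreducible T → IsClosed T → T ⊆ closure s →
    (∀ T' : Set X, IsIrreducible T' → IsClosed T' → T' ⊆ closure s → T ⊆ T' → T = T') →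
    ¬ T.Subsingleton → T ⊆ Δ

/-- `X` is arithmetically hyperbolic modulo `Δ` over `k`: for every finitely generated
subring `A ⊆ k` and every model `𝒳` of `X` over `A`, every positive-dimensional
irreducible component of the Zariski closure of the set of `A`-points `𝒳(A)` in `X`
is contained in `Δ`. -/
def ArithmeticallyHyperbolicModulo (k : Type) [Field k] (X : OverR k) (Δ : Set X.left) :
    Prop :=
  ∀ A : Subring k, Algebra.FiniteType ℤ ↥A →
    ∀ 𝒳 : SchemeModel k A X,
      ComponentsModulo Δ {x : X.left | ∃ s : SR ↥A ⟶ 𝒳.M, s ≫ 𝒳.str = 𝟙 (SR ↥A) ∧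
        𝒳.InducesPoint (Spec.map (CommRingCat.ofHom A.subtype) ≫ s) x}

/-- A model is pure if morphisms to it from big dense opens of smooth finite type
separated integral `A`-schemes extend (uniquely). -/
def SchemeModel.IsPure {k : Type} [Field k] {A : Subring k} {X : OverR k}
    (𝒳 : SchemeModel k A X) : Prop :=
  ∀ (T : Scheme) (tstr : T ⟶ SR ↥A), IsSmooth tstr → LocallyOfFiniteType tstr →
    QuasiCompact tstr → IsSeparated tstr → IsIntegral T →
    ∀ (U : T.Opens), Dense (U : Set T) → CodimAtLeastTwo ((U : Set T)ᶜ) →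
      ∀ g : U.toScheme ⟶ 𝒳.M, g ≫ 𝒳.str = U.ι ≫ tstr →
        ∃! g' : T ⟶ 𝒳.M, g' ≫ 𝒳.str = tstr ∧ U.ι ≫ g' = g

/-- `X` has an arithmetically-pure model: a pure model over some finitely generated
subring of `k`. -/
def HasArithmeticallyPureModel (k : Type) [Field k] (X : OverR k) : Prop :=
  ∃ A : Subring k, Algebra.FiniteType ℤ ↥A ∧ ∃ 𝒳 : SchemeModel k A X, 𝒳.IsPure

attribute [local instance] MvPolynomial.gradedAlgebra

/-- The projective line over `k`, as a scheme over `Spec k`. -/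
def P1 (k : Type) [CommRing k] : OverR k :=
  Over.mk (AlgebraicGeometry.Proj.toSpecZero (MvPolynomial.homogeneousSubmodule (Fin 2) k) ≫
    Spec.map (CommRingCat.ofHom
      (algebraMap k ↥(MvPolynomial.homogeneousSubmodule (Fin 2) k 0))))

lemma exists_smooth_aux {k : Type} [Field k] [CharZero k] (A : Subring k) [IsNoetherianRing A]
    (B : Subalgebra A k) (hB : B.FG) :
    ∃ (B' : Type) (_ : CommRing B') (_ : IsDomain B') (_ : Algebra A B') (_ : Algebra.Smooth A B')
      (j : B →ₐ[A] B') (φ : B' →ₐ[A] k), φ.comp j = B.val := by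
  have : Algebra.FiniteType A B := (Subalgebra.fg_iff_finiteType B).mp hB
  have : Algebra.FinitePresentation A B := Algebra.FinitePresentation.of_finiteType.mp this
  let K := FractionRing A
  let L := FractionRing B
  letI : Algebra K L := FractionRing.liftAlgebra A L
  have : IsScalarTower A K L := inferInstance
  have : CharZero A := inferInstance
  have : CharZero K := inferInstance
  have : Algebra.EssFiniteType B L := .of_isLocalization _ (nonZeroDivisors B)
  have : Algebra.EssFiniteType A L := .comp _ B _
  have : Algebra.EssFiniteType K L := .of_comp A K L
  have h1 : Algebra.FormallySmooth K L := inferInstance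
  have h2 : Algebra.FormallySmooth A K := .of_isLocalization (nonZeroDivisors A)
  have h3 : Algebra.FormallySmooth A L := .comp A K L
  let p : PrimeSpectrum B := ⟨⊥, Ideal.isPrime_bot⟩
  have hp : p ∈ Algebra.smoothLocus A B := by
    change Algebra.FormallySmooth A (Localization.AtPrime (⊥ : Ideal B))
    have : (⊥ : Ideal B).primeCompl = nonZeroDivisors B := by
      ext x; simp [Ideal.primeCompl, mem_nonZeroDivisors_iff_ne_zero]
    have e : IsLocalization (⊥ : Ideal B).primeCompl L := by rw [this]; infer_instance
    exact .of_equiv ((IsLocalization.algEquiv (⊥ : Ideal B).primeCompl L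
      (Localization.AtPrime (⊥ : Ideal B))).restrictScalars A)
  obtain ⟨_, ⟨_, ⟨b, rfl⟩, rfl⟩, hpb, hb⟩ :=
    PrimeSpectrum.isBasis_basic_opens.exists_subset_of_mem_open hp Algebra.isOpen_smoothLocus
  have hb0 : b ≠ 0 := by
    rintro rfl
    simp at hpb
  have hs := Algebra.basicOpen_subset_smoothLocus_iff_smooth.mp hb
  have hdom : IsDomain (Localization.Away b) :=
    IsLocalization.isDomain_localization (by
      rw [Submonoid.powers_le]; exact mem_nonZeroDivisors_of_ne_zero hb0)
  have hu : ∀ y : Submonoid.powers b, IsUnit (B.val y) := by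
    rintro ⟨_, n, rfl⟩
    simp [hb0]
  refine ⟨Localization.Away b, inferInstance, hdom, inferInstance, hs,
    IsScalarTower.toAlgHom A B _, IsLocalization.liftAlgHom (M := Submonoid.powers b) hu, ?_⟩
  ext x
  simp

open HomogeneousLocalization in
/-- The map out of a degree zero localization induced by a ring hom inverting the variable. -/
def awayHom {k : Type} [CommRing k] {R : Type} [CommRing R] (θ : MvPolynomial (Fin 2) k →+* R)
    (r : MvPolynomial (Fin 2) k)
    (h : IsUnit (θ r)) :
    Away (MvPolynomial.homogeneousSubmodule (Fin 2) k) r →+* R :=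
  (Localization.awayLift θ r h).comp
    (algebraMap (Away (MvPolynomial.homogeneousSubmodule (Fin 2) k) r) (Localization.Away r))

lemma awayHom_comp {k : Type} [CommRing k] {R S : Type} [CommRing R] [CommRing S]
    (θ : MvPolynomial (Fin 2) k →+* R) (g : R →+* S)
    (r : MvPolynomial (Fin 2) k) (h : IsUnit (θ r)) (h' : IsUnit ((g.comp θ) r)) :
    g.comp (awayHom θ r h) = awayHom (g.comp θ) r h' := by
  rw [awayHom, awayHom, ← RingHom.comp_assoc]
  congr 1
  apply IsLocalization.ringHom_ext (M := Submonoid.powers r)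
  ext x <;> simp [Localization.awayLift]

open HomogeneousLocalization in
lemma awayHom_awayMap {k : Type} [CommRing k] {R : Type} [CommRing R]
    (θ : MvPolynomial (Fin 2) k →+* R)
    (r s t : MvPolynomial (Fin 2) k) {e : ℕ}
    (hs : s ∈ MvPolynomial.homogeneousSubmodule (Fin 2) k e) (ht : t = r * s)
    (h : IsUnit (θ r)) (h' : IsUnit (θ t)) :
    (awayHom θ t h').comp (awayMap (MvPolynomial.homogeneousSubmodule (Fin 2) k) hs ht) =
      awayHom θ r h := by
  ext x
  simp only [awayHom, RingHom.comp_apply, HomogeneousLocalization.algebraMap_apply]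
  rw [val_awayMap]
  simp only [← RingHom.comp_apply]
  congr 1
  apply IsLocalization.ringHom_ext (M := Submonoid.powers r)
  ext x <;> simp [Localization.awayLift]

lemma X_mem_homog {k : Type} [CommRing k] (i : Fin 2) :
    (MvPolynomial.X i : MvPolynomial (Fin 2) k) ∈ MvPolynomial.homogeneousSubmodule (Fin 2) k 1 :=
  MvPolynomial.isHomogeneous_X _ _

/-- The standard chart of the projective line. -/
def chartι {k : Type} [CommRing k] (i : Fin 2) :
    Spec (CommRingCat.of (HomogeneousLocalization.Away
      (MvPolynomial.homogeneousSubmodule (Fin 2) k) (MvPolynomial.X i))) ⟶ (P1 k).left :=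
  Proj.awayι (MvPolynomial.homogeneousSubmodule (Fin 2) k) (MvPolynomial.X i) (X_mem_homog i)
    one_pos

lemma chart_indep {k : Type} [CommRing k] {R : Type} [CommRing R]
    (θ : MvPolynomial (Fin 2) k →+* R) (i j : Fin 2)
    (hi : IsUnit (θ (MvPolynomial.X i))) (hj : IsUnit (θ (MvPolynomial.X j))) :
    Spec.map (CommRingCat.ofHom (awayHom θ _ hi)) ≫ chartι i =
      Spec.map (CommRingCat.ofHom (awayHom θ _ hj)) ≫ chartι j := by
  have ht : IsUnit (θ (MvPolynomial.X i * MvPolynomial.X j)) := by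
    rw [map_mul]; exact hi.mul hj
  change _ ≫ Proj.awayι (MvPolynomial.homogeneousSubmodule (Fin 2) k) (MvPolynomial.X i)
      (X_mem_homog i) one_pos = _ ≫ Proj.awayι (MvPolynomial.homogeneousSubmodule (Fin 2) k)
        (MvPolynomial.X j) (X_mem_homog j) one_pos
  rw [← awayHom_awayMap θ (.X i) (.X j) _ (X_mem_homog j) rfl hi ht,
    ← awayHom_awayMap θ (.X j) (.X i) _ (X_mem_homog i) (mul_comm _ _) hj ht,
    CommRingCat.ofHom_comp, CommRingCat.ofHom_comp, Spec.map_comp, Spec.map_comp,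
    Category.assoc, Category.assoc, Proj.SpecMap_awayMap_awayι, Proj.SpecMap_awayMap_awayι]

lemma chart_str {k : Type} [CommRing k] {R : Type} [CommRing R]
    (θ : MvPolynomial (Fin 2) k →+* R) (i : Fin 2)
    (hi : IsUnit (θ (MvPolynomial.X i))) :
    Spec.map (CommRingCat.ofHom (awayHom θ _ hi)) ≫ chartι i ≫ (P1 k).hom =
      Spec.map (CommRingCat.ofHom (θ.comp MvPolynomial.C)) := by
  change _ ≫ Proj.awayι (MvPolynomial.homogeneousSubmodule (Fin 2) k) (MvPolynomial.X i)
      (X_mem_homog i) one_pos ≫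
      AlgebraicGeometry.Proj.toSpecZero (MvPolynomial.homogeneousSubmodule (Fin 2) k) ≫
    Spec.map (CommRingCat.ofHom
      (algebraMap k ↥(MvPolynomial.homogeneousSubmodule (Fin 2) k 0))) = _
  rw [Proj.awayι_toSpecZero_assoc, ← Spec.map_comp, ← Spec.map_comp, ← CommRingCat.ofHom_comp,
    ← CommRingCat.ofHom_comp]
  congr 2
  ext x
  simp only [awayHom, RingHom.comp_apply, HomogeneousLocalization.algebraMap_apply]
  change Localization.awayLift θ _ hi (Localization.mk (MvPolynomial.C x) 1) = _
  rw [Localization.mk_one_eq_algebraMap]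
  exact IsLocalization.Away.lift_eq _ _ _

/-- basic open -/
def bo {P : Type} [CommRing P] (r : P) : (SR P).Opens :=
  (PrimeSpectrum.basicOpen r : TopologicalSpace.Opens (PrimeSpectrum P))

/-- Punctured affine plane. -/
def punct (B : Type) [CommRing B] : (SR (MvPolynomial (Fin 2) B)).Opens :=
  ⨆ i : Fin 2, bo (MvPolynomial.X i)

/-- ring hom corresponding to a map to an affine scheme -/
def glob {P : Type} [CommRing P] {Z : Scheme.{0}} (z : Z ⟶ SR P) : P →+* Γ(Z, ⊤) :=
  ((Scheme.ΓSpecIso (.of P)).inv ≫ z.appTop).hom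

lemma toSpec_glob {P : Type} [CommRing P] {Z : Scheme.{0}} (z : Z ⟶ SR P) :
    Z.toSpecΓ ≫ Spec.map (CommRingCat.ofHom (glob z)) = z := by
  simp only [glob, CommRingCat.ofHom_hom, Spec.map_comp]
  rw [← Category.assoc, ← Scheme.toSpecΓ_naturality, Category.assoc, toSpecΓ_SpecMap_ΓSpecIso_inv]
  simp

lemma glob_comp {P : Type} [CommRing P] {Z Y : Scheme.{0}} (z : Z ⟶ SR P) (w : Y ⟶ Z) :
    glob (w ≫ z) = w.appTop.hom.comp (glob z) := by
  simp [glob]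
  rfl

lemma glob_isUnit {P : Type} [CommRing P] {Z : Scheme.{0}} (z : Z ⟶ SR P) (r : P)
    (h : ∀ x, z x ∈ bo r) : IsUnit (glob z r) := by
  have h1 : Z.basicOpen (glob z r) = ⊤ := by
    rw [eq_top_iff]
    intro x _
    have : Z.basicOpen (glob z r) = z ⁻¹ᵁ (bo r) := by
      have e : bo r = (SR P).basicOpen ((Scheme.ΓSpecIso (.of P)).inv r) :=
        (basicOpen_eq_of_affine (R := .of P) r).symm
      rw [e]
      exact (Scheme.preimage_basicOpen z ((Scheme.ΓSpecIso (.of P)).inv r)).symm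
    rw [this]
    exact h x
  apply RingedSpace.isUnit_of_isUnit_germ
  intro x hx
  have : x ∈ Z.basicOpen (glob z r) := by rw [h1]; trivial
  rwa [Scheme.mem_basicOpen _ _ x hx] at this

/-- the map to the projective line -/
def mm {k : Type} [CommRing k] {Z : Scheme.{0}} (z : Z ⟶ SR (MvPolynomial (Fin 2) k)) (i : Fin 2)
    (h : IsUnit (glob z (.X i))) : Z ⟶ (P1 k).left :=
  Z.toSpecΓ ≫ Spec.map (CommRingCat.ofHom (awayHom (glob z) _ h)) ≫ chartι i

lemma mm_comp {k : Type} [CommRing k] {Z Y : Scheme.{0}} (z : Z ⟶ SR (MvPolynomial (Fin 2) k))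
    (i : Fin 2) (h : IsUnit (glob z (.X i))) (w : Y ⟶ Z) (y : Y ⟶ SR (MvPolynomial (Fin 2) k))
    (hy : w ≫ z = y) (h' : IsUnit (glob y (.X i))) :
    w ≫ mm z i h = mm y i h' := by
  subst hy
  rw [mm, mm, ← Category.assoc, Scheme.toSpecΓ_naturality]
  have := awayHom_comp (glob z) w.appTop.hom _ h (by rw [← glob_comp]; exact h')
  simp only [glob_comp, ← this, CommRingCat.ofHom_comp, Spec.map_comp, Category.assoc]
  rfl

lemma mm_indep {k : Type} [CommRing k] {Z : Scheme.{0}} (z : Z ⟶ SR (MvPolynomial (Fin 2) k))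
    (i j : Fin 2) (h : IsUnit (glob z (.X i))) (h' : IsUnit (glob z (.X j))) :
    mm z i h = mm z j h' := by
  rw [mm, mm, chart_indep _ i j h h']

lemma mm_str {k : Type} [CommRing k] {Z : Scheme.{0}} (z : Z ⟶ SR (MvPolynomial (Fin 2) k))
    (i : Fin 2) (h : IsUnit (glob z (.X i))) :
    mm z i h ≫ (P1 k).hom = z ≫ Spec.map (CommRingCat.ofHom MvPolynomial.C) := by
  rw [mm, Category.assoc, Category.assoc, chart_str, CommRingCat.ofHom_comp, Spec.map_comp,
    ← Category.assoc, toSpec_glob]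

lemma mm_spec {k : Type} [CommRing k] {R : Type} [CommRing R]
    (θ : MvPolynomial (Fin 2) k →+* R) (i : Fin 2)
    (h : IsUnit (θ (.X i))) (h' : IsUnit (glob (Spec.map (CommRingCat.ofHom θ)) (.X i))) :
    mm (Spec.map (CommRingCat.ofHom θ)) i h' =
      Spec.map (CommRingCat.ofHom (awayHom θ _ h)) ≫ chartι i := by
  have e : glob (Spec.map (CommRingCat.ofHom θ)) =
      ((Scheme.ΓSpecIso (.of R)).inv.hom).comp θ := by
    rw [glob, ← Scheme.ΓSpecIso_inv_naturality]; rfl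
  have := awayHom_comp θ (Scheme.ΓSpecIso (.of R)).inv.hom _ h (by rw [← e]; exact h')
  simp only [mm, e, ← this, CommRingCat.ofHom_comp, Spec.map_comp, Category.assoc]
  rw [CommRingCat.ofHom_hom, reassoc_of% toSpecΓ_SpecMap_ΓSpecIso_inv (.of R)]

lemma glue_iSup {Y Z : Scheme.{0}} {ι : Type} (V : ι → Y.Opens) (m : ∀ i, (V i).toScheme ⟶ Z)
    (h : ∀ (i j : ι) (W : Scheme.{0}) (a : W ⟶ V i) (b : W ⟶ V j), a ≫ (V i).ι = b ≫ (V j).ι →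
      a ≫ m i = b ≫ m j) :
    ∃ π : (⨆ i, V i).toScheme ⟶ Z, ∀ i, Y.homOfLE (le_iSup V i) ≫ π = m i := by
  let 𝒰 : (⨆ i, V i).toScheme.OpenCover := Scheme.Opens.iSupOpenCover V
  refine ⟨𝒰.glueMorphisms m ?_, fun i => 𝒰.ι_glueMorphisms _ _ i⟩
  intro i j
  refine h i j _ _ _ ?_
  have h𝒰 : ∀ i, 𝒰.f i ≫ (⨆ i, V i).ι = (V i).ι := fun i => Scheme.homOfLE_ι _ (le_iSup V i)
  have := pullback.condition_assoc (f := 𝒰.f i) (g := 𝒰.f j) (⨆ i, V i).ι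
  have e1 := h𝒰 i
  have e2 := h𝒰 j
  exact (congrArg (pullback.fst _ _ ≫ ·) e1).symm.trans
    (this.trans (congrArg (pullback.snd _ _ ≫ ·) e2))

lemma iSup_hom_ext {Y Z : Scheme.{0}} {ι : Type} (V : ι → Y.Opens) (f g : (⨆ i, V i).toScheme ⟶ Z)
    (h : ∀ i, Y.homOfLE (le_iSup V i) ≫ f = Y.homOfLE (le_iSup V i) ≫ g) : f = g :=
  (Scheme.Opens.iSupOpenCover V).hom_ext _ _ h

lemma glue_iSup' {Y Z : Scheme.{0}} {ι : Type} (V : ι → Y.Opens) (U : Y.Opens) (hU : U = ⨆ i, V i)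
    (hV : ∀ i, V i ≤ U) (m : ∀ i, (V i).toScheme ⟶ Z)
    (h : ∀ (i j : ι) (W : Scheme.{0}) (a : W ⟶ V i) (b : W ⟶ V j), a ≫ (V i).ι = b ≫ (V j).ι →
      a ≫ m i = b ≫ m j) :
    ∃ π : U.toScheme ⟶ Z, ∀ i, Y.homOfLE (hV i) ≫ π = m i := by
  subst hU; exact glue_iSup V m h

lemma iSup_hom_ext' {Y Z : Scheme.{0}} {ι : Type} (V : ι → Y.Opens) (U : Y.Opens)
    (hU : U = ⨆ i, V i) (hV : ∀ i, V i ≤ U) (f g : U.toScheme ⟶ Z)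
    (h : ∀ i, Y.homOfLE (hV i) ≫ f = Y.homOfLE (hV i) ≫ g) : f = g := by
  subst hU; exact iSup_hom_ext V f g h

lemma exists_proj (k : Type) [CommRing k] :
    ∃ π : (punct k).toScheme ⟶ (P1 k).left,
      π ≫ (P1 k).hom = (punct k).ι ≫ Spec.map (CommRingCat.ofHom MvPolynomial.C) ∧
      ∀ (R : Type) [CommRing R] (θ : MvPolynomial (Fin 2) k →+* R) (i : Fin 2)
        (h : IsUnit (θ (.X i))) (q : SR R ⟶ (punct k).toScheme),
        q ≫ (punct k).ι = Spec.map (CommRingCat.ofHom θ) →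
        q ≫ π = Spec.map (CommRingCat.ofHom (awayHom θ _ h)) ≫ chartι i := by
  let V : Fin 2 → (SR (MvPolynomial (Fin 2) k)).Opens := fun i => bo (.X i)
  have hU : punct k = ⨆ i, V i := rfl
  have hVU : ∀ i, V i ≤ punct k := fun i => le_iSup V i
  have hV : ∀ i, IsUnit (glob (V i).ι (MvPolynomial.X i)) := fun i =>
    glob_isUnit _ _ (fun x => x.2)
  have key : ∀ i : Fin 2, ∀ {Z : Scheme.{0}} (w : Z ⟶ V i),
      IsUnit (glob (w ≫ (V i).ι) (MvPolynomial.X i)) := fun i Z w => by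
    rw [glob_comp]; exact (hV i).map w.appTop.hom
  obtain ⟨π, hπ⟩ := glue_iSup' V _ hU hVU (fun i => mm (V i).ι i (hV i)) (by
      intro i j W a b e
      refine (mm_comp _ _ _ _ _ e (e ▸ key i _)).trans ?_
      refine Eq.trans ?_ (mm_comp _ _ _ _ _ rfl (key j _)).symm
      exact mm_indep _ _ _ _ _)
  refine ⟨π, ?_, ?_⟩
  · refine iSup_hom_ext' V _ hU hVU _ _ fun i => ?_
    rw [reassoc_of% hπ i, mm_str, Scheme.homOfLE_ι_assoc]
  · intro R _ θ i h q hq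
    have hr : Set.range (q ≫ (punct k).ι) ⊆ Set.range (V i).ι := by
      rintro _ ⟨x, rfl⟩
      simp only [Scheme.Opens.range_ι]
      rw [hq]
      intro hx
      exact x.2.ne_top (Ideal.eq_top_of_isUnit_mem _ hx h)
    let q' : SR R ⟶ V i := IsOpenImmersion.lift (V i).ι _ hr
    have hq' : q' ≫ (SR _).homOfLE (hVU i) = q := by
      rw [← cancel_mono (punct k).ι, Category.assoc, Scheme.homOfLE_ι]
      exact IsOpenImmersion.lift_fac _ _ _
    have h2 : q' ≫ (V i).ι = Spec.map (CommRingCat.ofHom θ) :=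
      (IsOpenImmersion.lift_fac _ _ hr).trans hq
    rw [← hq', ← mm_spec θ i h (h2 ▸ key i q'), Category.assoc, hπ]
    exact mm_comp _ _ _ _ _ h2 _


lemma homog_eval {k : Type} [CommRing k] {R : Type} [CommRing R]
    (φ : MvPolynomial (Fin 2) k →+* R) (s : R) (p : MvPolynomial (Fin 2) k) (n : ℕ)
    (hp : p.IsHomogeneous n) :
    MvPolynomial.eval₂Hom (φ.comp MvPolynomial.C) (fun j => s * φ (.X j)) p = s ^ n * φ p := by
  conv_rhs => rw [p.as_sum]
  rw [MvPolynomial.coe_eval₂Hom, MvPolynomial.eval₂_eq', map_sum, Finset.mul_sum]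
  refine Finset.sum_congr rfl fun d hd => ?_
  have h1 : d.degree = n := by
    have := hp (MvPolynomial.mem_support_iff.mp hd)
    rw [Finsupp.degree_eq_weight_one]; exact this
  rw [MvPolynomial.monomial_eq, map_mul, Finsupp.prod_fintype _ _ (by simp), map_prod]
  simp only [mul_pow, Finset.prod_mul_distrib, map_pow, RingHom.comp_apply,
    Finset.prod_pow_eq_pow_sum]
  rw [← h1, Finsupp.degree_eq_sum]
  ring

/-- coordinate ring of a chart -/
abbrev Ch (k : Type) [CommRing k] (i : Fin 2) : Type :=
  HomogeneousLocalization.Away (MvPolynomial.homogeneousSubmodule (Fin 2) k) (MvPolynomial.X i)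

instance (k : Type) [Field k] (i : Fin 2) : IsDomain (Ch k i) := by
  have : IsDomain (Localization.Away (MvPolynomial.X i : MvPolynomial (Fin 2) k)) :=
    IsLocalization.isDomain_localization
      (powers_le_nonZeroDivisors_of_noZeroDivisors (MvPolynomial.X_ne_zero i))
  exact Function.Injective.isDomain
    (algebraMap (Ch k i) (Localization.Away (MvPolynomial.X i : MvPolynomial (Fin 2) k)))
    (HomogeneousLocalization.val_injective _)

/-- structure map of the chart -/
def chσ {k : Type} [CommRing k] (i : Fin 2) : k →+* Ch k i :=
  (HomogeneousLocalization.fromZeroRingHom (MvPolynomial.homogeneousSubmodule (Fin 2) k)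
    (Submonoid.powers (MvPolynomial.X i))).comp
      (algebraMap k ↥(MvPolynomial.homogeneousSubmodule (Fin 2) k 0))

lemma chσ_val {k : Type} [CommRing k] (i : Fin 2) (x : k) : (chσ i x : Ch k i).val =
    algebraMap (MvPolynomial (Fin 2) k) _ (MvPolynomial.C x) := by
  rw [← Localization.mk_one_eq_algebraMap]; rfl

lemma chartι_hom {k : Type} [CommRing k] (i : Fin 2) : chartι i ≫ (P1 k).hom =
    Spec.map (CommRingCat.ofHom (chσ i)) := by
  change Proj.awayι (MvPolynomial.homogeneousSubmodule (Fin 2) k) (MvPolynomial.X i)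
      (X_mem_homog i) one_pos ≫
      AlgebraicGeometry.Proj.toSpecZero (MvPolynomial.homogeneousSubmodule (Fin 2) k) ≫
    Spec.map (CommRingCat.ofHom
      (algebraMap k ↥(MvPolynomial.homogeneousSubmodule (Fin 2) k 0))) = _
  rw [Proj.awayι_toSpecZero_assoc, ← Spec.map_comp]
  rfl

/-- affine coordinates -/
def chv {k : Type} [CommRing k] (i j : Fin 2) : Ch k i :=
  HomogeneousLocalization.Away.mk _ (X_mem_homog i) 1 (MvPolynomial.X j)
    (X_mem_homog j)

/-- dehomogenization -/
def che {k : Type} [CommRing k] (i : Fin 2) : MvPolynomial (Fin 2) k →+* Ch k i :=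
  MvPolynomial.eval₂Hom (chσ i) (chv i)

lemma ch_mk_val {k : Type} [CommRing k] (i : Fin 2) (n : ℕ) (p : MvPolynomial (Fin 2) k)
    (hp : p ∈ MvPolynomial.homogeneousSubmodule (Fin 2) k (n • 1)) :
    (HomogeneousLocalization.Away.mk _ (X_mem_homog i) n p hp : Ch k i).val =
      IsLocalization.Away.invSelf (MvPolynomial.X i : MvPolynomial (Fin 2) k) ^ n *
        algebraMap (MvPolynomial (Fin 2) k) (Localization.Away (MvPolynomial.X i)) p := by
  rw [HomogeneousLocalization.Away.val_mk, Localization.mk_eq_mk',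
    IsLocalization.mk'_eq_iff_eq_mul]
  rw [mul_right_comm, map_pow, ← mul_pow, mul_comm (IsLocalization.Away.invSelf _),
    IsLocalization.Away.mul_invSelf, one_pow, one_mul]

lemma che_homog {k : Type} [CommRing k] (i : Fin 2) (n : ℕ) (p : MvPolynomial (Fin 2) k)
    (hp : p ∈ MvPolynomial.homogeneousSubmodule (Fin 2) k (n • 1)) :
    che i p = HomogeneousLocalization.Away.mk _ (X_mem_homog i) n p hp := by
  apply HomogeneousLocalization.val_injective
  have h := homog_eval (algebraMap (MvPolynomial (Fin 2) k)
    (Localization.Away (MvPolynomial.X i : MvPolynomial (Fin 2) k)))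
    (IsLocalization.Away.invSelf (MvPolynomial.X i : MvPolynomial (Fin 2) k)) p n (by simpa using hp)
  have e : (algebraMap (Ch k i) (Localization.Away (MvPolynomial.X i : MvPolynomial (Fin 2) k))).comp (che i) =
      MvPolynomial.eval₂Hom
      ((algebraMap (MvPolynomial (Fin 2) k)
        (Localization.Away (MvPolynomial.X i))).comp MvPolynomial.C)
      (fun j => IsLocalization.Away.invSelf (MvPolynomial.X i : MvPolynomial (Fin 2) k) *
        algebraMap (MvPolynomial (Fin 2) k) (Localization.Away (MvPolynomial.X i)) (.X j)) := by
    apply MvPolynomial.ringHom_ext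
    · intro r
      simp only [che, RingHom.comp_apply, MvPolynomial.eval₂Hom_C,
        HomogeneousLocalization.algebraMap_apply, chσ_val]
    · intro j
      simp only [che, RingHom.comp_apply, MvPolynomial.eval₂Hom_X',
        HomogeneousLocalization.algebraMap_apply, chv, ch_mk_val, pow_one]
  rw [ch_mk_val, ← h, ← e]
  rfl

open Polynomial in
/-- the blow up chart -/
def chh {k : Type} [CommRing k] (i : Fin 2) : MvPolynomial (Fin 2) k →+* (Ch k i)[X] :=
  MvPolynomial.eval₂Hom ((Polynomial.C.comp (che i)).comp MvPolynomial.C)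
    (fun j => Polynomial.X * (Polynomial.C.comp (che i)) (MvPolynomial.X j))

lemma chh_C {k : Type} [CommRing k] (i : Fin 2) :
    (chh i).comp MvPolynomial.C = Polynomial.C.comp (chσ i : k →+* _) := by
  ext1 x
  simp [chh, che]

lemma chv_self {k : Type} [CommRing k] (i : Fin 2) : (chv i i : Ch k i) = 1 := by
  apply HomogeneousLocalization.val_injective
  rw [chv, ch_mk_val, HomogeneousLocalization.val_one, pow_one, mul_comm,
    IsLocalization.Away.mul_invSelf]

lemma chh_X {k : Type} [CommRing k] (i : Fin 2) :
    (chh i) (MvPolynomial.X i : MvPolynomial (Fin 2) k) = Polynomial.X := by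
  simp [chh, che, chv_self]

/-- on the Laurent polynomials -/
def chθ {k : Type} [CommRing k] (i : Fin 2) :
    MvPolynomial (Fin 2) k →+* LaurentPolynomial (Ch k i) :=
  (Polynomial.toLaurent : _ →+* _).comp (chh i)

lemma chθ_unit {k : Type} [CommRing k] (i : Fin 2) :
    IsUnit (chθ i (MvPolynomial.X i : MvPolynomial (Fin 2) k)) := by
  rw [chθ, RingHom.comp_apply, chh_X, Polynomial.toLaurent_X]
  exact LaurentPolynomial.isUnit_T 1

lemma awayHom_mk {k : Type} [CommRing k] {R : Type} [CommRing R]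
    (θ : MvPolynomial (Fin 2) k →+* R) (i : Fin 2) (h : IsUnit (θ (.X i)))
    (n : ℕ) (p : MvPolynomial (Fin 2) k)
    (hp : p ∈ MvPolynomial.homogeneousSubmodule (Fin 2) k (n • 1)) :
    θ (.X i) ^ n * awayHom θ _ h (HomogeneousLocalization.Away.mk _ (X_mem_homog i) n p hp)
      = θ p := by
  rw [awayHom, RingHom.comp_apply, HomogeneousLocalization.algebraMap_apply,
    HomogeneousLocalization.Away.val_mk, Localization.mk_eq_mk']
  have h1 : ∀ q, Localization.awayLift θ _ h (algebraMap _ _ q) = θ q :=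
    fun q => IsLocalization.Away.lift_eq _ _ _
  rw [← map_pow, ← h1, ← map_mul, IsLocalization.mk'_spec'_mk, h1]

lemma awayHom_chθ {k : Type} [CommRing k] (i : Fin 2) :
    awayHom (chθ i) _ (chθ_unit (k := k) i) =
      (Polynomial.toLaurent : _ →+* _).comp Polynomial.C := by
  ext1 x
  obtain ⟨n, p, hp, rfl⟩ := HomogeneousLocalization.Away.mk_surjective _ (X_mem_homog i) x
  have h1 := awayHom_mk (chθ i) i (chθ_unit i) n p hp
  have hu := (chθ_unit (k := k) i).pow n
  rw [← hu.mul_right_inj, h1, ← che_homog, chθ]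
  simp only [RingHom.comp_apply, chh_X]
  rw [chh, homog_eval _ _ p n (by simpa using hp)]
  simp

/-- evaluation at the origin -/
def ev0 (k : Type) [CommRing k] : MvPolynomial (Fin 2) k →+* k :=
  MvPolynomial.eval₂Hom (RingHom.id k) (fun _ => 0)

lemma chh_zero {k : Type} [CommRing k] (i : Fin 2) :
    (Polynomial.evalRingHom 0).comp (chh i) = (chσ i : k →+* _).comp (ev0 k) := by
  apply MvPolynomial.ringHom_ext
  · intro r; simp [chh, che, ev0]
  · intro r; simp [chh, ev0]

lemma P1_hom_ext {k : Type} [CommRing k] {Z : Scheme.{0}} (f g : (P1 k).left ⟶ Z)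
    (h : ∀ i, chartι i ≫ f = chartι i ≫ g) : f = g := by
  let 𝒰 := Proj.affineOpenCoverOfIrrelevantLESpan (MvPolynomial.homogeneousSubmodule (Fin 2) k)
    (fun i : Fin 2 => (MvPolynomial.X i : MvPolynomial (Fin 2) k)) (m := fun _ => 1)
    (fun i => X_mem_homog i) (fun _ => one_pos) (by
      intro p hp
      have h0 : MvPolynomial.constantCoeff p = 0 := by
        have := (HomogeneousIdeal.mem_irrelevant_iff _ _).mp hp
        have h1 := (MvPolynomial.decomposition.decompose'_apply p 0).symm.trans this
        rw [MvPolynomial.homogeneousComponent_zero] at h1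
        exact MvPolynomial.C_injective _ _ (h1.trans (map_zero _).symm)
      rw [← Set.image_univ, MvPolynomial.mem_ideal_span_X_image]
      intro m hm
      by_contra! hc
      have : m = 0 := by ext j; exact hc j trivial
      subst this
      exact (MvPolynomial.mem_support_iff.mp hm) h0)
  exact 𝒰.openCover.hom_ext _ _ h

lemma lemmaK {k : Type} [Field k] (X : OverR k) (hX : IsSeparated X.hom) (f : P1 k ⟶ X)
    (π : (punct k).toScheme ⟶ (P1 k).left)
    (hπ : ∀ (R : Type) [CommRing R] (θ : MvPolynomial (Fin 2) k →+* R) (i : Fin 2)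
        (h : IsUnit (θ (.X i))) (q : SR R ⟶ (punct k).toScheme),
        q ≫ (punct k).ι = Spec.map (CommRingCat.ofHom θ) →
        q ≫ π = Spec.map (CommRingCat.ofHom (awayHom θ _ h)) ≫ chartι i)
    (G : SR (MvPolynomial (Fin 2) k) ⟶ X.left)
    (hG : G ≫ X.hom = Spec.map (CommRingCat.ofHom MvPolynomial.C))
    (hG' : (punct k).ι ≫ G = π ≫ f.left) : IsConstant f := by
  refine ⟨Spec.map (CommRingCat.ofHom (ev0 k)) ≫ G, ?_⟩
  refine P1_hom_ext _ _ fun i => ?_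
  let ι : SR (LaurentPolynomial (Ch k i)) ⟶ SR (Polynomial (Ch k i)) :=
    Spec.map (CommRingCat.ofHom (Polynomial.toLaurent : _ →+* _))
  have hι : IsDominant ι := by
    constructor
    refine (PrimeSpectrum.denseRange_comap_iff_ker_le_nilRadical _).mpr ?_
    change RingHom.ker (Polynomial.toLaurent : Polynomial (Ch k i) →+* LaurentPolynomial (Ch k i)) ≤ _
    exact ((RingHom.injective_iff_ker_eq_bot
      (Polynomial.toLaurent : Polynomial (Ch k i) →+* LaurentPolynomial (Ch k i))).mp
        Polynomial.toLaurent_injective).le.trans bot_le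
  have hr : Set.range (Spec.map (CommRingCat.ofHom (chθ (k := k) i))) ⊆
      Set.range (punct k).ι := by
    rintro _ ⟨x, rfl⟩
    simp only [Scheme.Opens.range_ι]
    apply le_iSup (fun i : Fin 2 => bo (MvPolynomial.X i : MvPolynomial (Fin 2) k)) i
    intro hx
    exact x.2.ne_top (Ideal.eq_top_of_isUnit_mem _ hx (chθ_unit i))
  let q := IsOpenImmersion.lift (punct k).ι _ hr
  have hq : q ≫ (punct k).ι = _ := IsOpenImmersion.lift_fac _ _ hr
  have h1 := hπ _ _ i (chθ_unit i) q hq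
  have key : Spec.map (CommRingCat.ofHom (chh i)) ≫ G =
      Spec.map (CommRingCat.ofHom Polynomial.C) ≫ chartι i ≫ f.left := by
    apply ext_of_isDominant_of_isSeparated X.hom ?_ ι ?_
    · simp only [Category.assoc, hG]
      rw [Over.w f, chartι_hom, ← Spec.map_comp, ← Spec.map_comp, ← CommRingCat.ofHom_comp,
        ← CommRingCat.ofHom_comp, chh_C]
    · simp only [ι]
      rw [← Spec.map_comp_assoc, ← Spec.map_comp_assoc, ← CommRingCat.ofHom_comp,
        ← CommRingCat.ofHom_comp, ← awayHom_chθ]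
      change Spec.map (CommRingCat.ofHom (chθ i)) ≫ G = _
      rw [← hq, Category.assoc, hG', reassoc_of% h1]
  have := congrArg (Spec.map (CommRingCat.ofHom (Polynomial.evalRingHom (0 : Ch k i))) ≫ ·) key
  simp only [← Spec.map_comp_assoc, ← CommRingCat.ofHom_comp, chh_zero] at this
  have e : (Polynomial.evalRingHom (0 : Ch k i)).comp Polynomial.C = RingHom.id _ := by
    ext x; simp
  rw [e] at this
  rw [CommRingCat.ofHom_comp, Spec.map_comp_assoc] at this
  rw [reassoc_of% chartι_hom (k := k) i, this]
  exact (Category.id_comp _).symm.trans (congrArg (· ≫ _) (Spec.map_id _).symm)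


lemma spread_opens {I : Type} [Category.{0} I] [IsCofiltered I] {S X : Scheme.{0}}
    (D : I ⥤ Scheme.{0}) (t : D ⟶ (Functor.const I).obj S) (f : X ⟶ S) (c : Cone D)
    (hc : IsLimit c) [LocallyOfFinitePresentation f]
    [∀ {i j} (f : i ⟶ j), IsAffineHom (D.map f)]
    [∀ i, CompactSpace (D.obj i)] [∀ i, QuasiSeparatedSpace (D.obj i)]
    (i : I) (U : (D.obj i).Opens) (hU : IsCompact (U : Set (D.obj i)))
    (a : (c.π.app i ⁻¹ᵁ U).toScheme ⟶ X)
    (ha : a ≫ f = (c.π.app i ⁻¹ᵁ U).ι ≫ c.π.app i ≫ t.app i) :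
    ∃ (j : I) (φ : j ⟶ i) (g : (D.map φ ⁻¹ᵁ U).toScheme ⟶ X)
      (r : (c.π.app i ⁻¹ᵁ U).toScheme ⟶ (D.map φ ⁻¹ᵁ U).toScheme),
      r ≫ (D.map φ ⁻¹ᵁ U).ι = (c.π.app i ⁻¹ᵁ U).ι ≫ c.π.app j ∧
      r ≫ g = a ∧ g ≫ f = (D.map φ ⁻¹ᵁ U).ι ≫ t.app j := by
  let t' : opensDiagram D i U ⟶ (Functor.const (Over i)).obj S :=
    { app j := (D.map j.hom ⁻¹ᵁ U).ι ≫ t.app j.left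
      naturality j j' f := by
        have := t.naturality f.left
        simp only [Functor.const_obj_map, Functor.const_obj_obj, Category.comp_id] at this
        simp [opensDiagram, this] }
  have h1 (j : Over i) : CompactSpace ↥((opensDiagram D i U).obj j) :=
    isCompact_iff_compactSpace.mp (QuasiCompact.isCompact_preimage (f := (D.map j.hom)) _ U.2 hU)
  have h2 (j : Over i) : QuasiSeparatedSpace ↥((opensDiagram D i U).obj j) :=
    QuasiSeparatedSpace.of_isOpenEmbedding (D.map j.hom ⁻¹ᵁ U).ι.isOpenEmbedding
  obtain ⟨j, g, hg, hg'⟩ := Scheme.exists_π_app_comp_eq_of_locallyOfFinitePresentation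
    (opensDiagram D i U) t' f (opensCone D c i U) (isLimitOpensCone D c hc i U) a (by
      ext j
      have h3 := t.naturality j.hom
      simp only [Functor.const_obj_map, Functor.const_obj_obj, Category.comp_id] at h3
      have h4 : c.π.app j.left ≫ t.app j.left = c.π.app i ≫ t.app i := by
        rw [← h3, reassoc_of% c.w j.hom]
      refine Eq.trans ?_ (((congrArg (fun z => (c.π.app i ⁻¹ᵁ U).ι ≫ z) h4).trans ha.symm))
      have h6 : c.π.app i ⁻¹ᵁ U ≤ c.π.app j.left ⁻¹ᵁ D.map j.hom ⁻¹ᵁ U := by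
        rw [← Scheme.Hom.comp_preimage, c.w]
      change Scheme.Hom.resLE (c.π.app j.left) (D.map j.hom ⁻¹ᵁ U) (c.π.app i ⁻¹ᵁ U) h6 ≫
        (D.map j.hom ⁻¹ᵁ U).ι ≫ t.app j.left = _
      exact Scheme.Hom.resLE_comp_ι_assoc _ _ _)
  refine ⟨j.left, j.hom, g, (opensCone D c i U).π.app j, ?_, hg, hg'⟩
  exact Scheme.Hom.resLE_comp_ι _ _

lemma spread_opens' {I : Type} [Category.{0} I] [IsCofiltered I] {S X : Scheme.{0}}
    (D : I ⥤ Scheme.{0}) (t : D ⟶ (Functor.const I).obj S) (f : X ⟶ S) (c : Cone D)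
    (hc : IsLimit c) [LocallyOfFinitePresentation f]
    [∀ {i j} (f : i ⟶ j), IsAffineHom (D.map f)]
    [∀ i, CompactSpace (D.obj i)] [∀ i, QuasiSeparatedSpace (D.obj i)]
    (i : I) (W : ∀ j, (D.obj j).Opens) (hU : IsCompact (W i : Set (D.obj i)))
    (hW : ∀ j (φ : j ⟶ i), D.map φ ⁻¹ᵁ (W i) = W j)
    (V : c.pt.Opens) (hV : c.π.app i ⁻¹ᵁ (W i) = V)
    (a : V.toScheme ⟶ X)
    (ha : a ≫ f = V.ι ≫ c.π.app i ≫ t.app i) :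
    ∃ (j : I) (g : (W j).toScheme ⟶ X) (r : V.toScheme ⟶ (W j).toScheme),
      r ≫ (W j).ι = V.ι ≫ c.π.app j ∧ r ≫ g = a ∧ g ≫ f = (W j).ι ≫ t.app j := by
  subst hV
  obtain ⟨j, φ, h⟩ := spread_opens D t f c hc i (W i) hU a ha
  refine ⟨j, ?_⟩
  have key : ∀ (W' : (D.obj j).Opens) (_ : D.map φ ⁻¹ᵁ (W i) = W'),
      ∃ (g : W'.toScheme ⟶ X) (r : (c.π.app i ⁻¹ᵁ (W i)).toScheme ⟶ W'.toScheme),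
      r ≫ W'.ι = (c.π.app i ⁻¹ᵁ (W i)).ι ≫ c.π.app j ∧ r ≫ g = a ∧
        g ≫ f = W'.ι ≫ t.app j := by
    rintro _ rfl
    exact h
  exact key _ (hW j φ)

/-- functoriality of the affine plane -/
abbrev pmap {B B' : Type} [CommRing B] [CommRing B'] (g : B →+* B') :
    SR (MvPolynomial (Fin 2) B') ⟶ SR (MvPolynomial (Fin 2) B) :=
  Spec.map (CommRingCat.ofHom (MvPolynomial.map g))

lemma punct_preimage {B B' : Type} [CommRing B] [CommRing B'] (g : B →+* B') :
    pmap g ⁻¹ᵁ punct B = punct B' := by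
  have : ∀ i : Fin 2, pmap g ⁻¹ᵁ (bo (.X i)) = bo (.X i) := by
    intro i
    ext x
    change (MvPolynomial.map g (MvPolynomial.X i) ∉ x.asIdeal) ↔ (MvPolynomial.X i ∉ x.asIdeal)
    rw [MvPolynomial.map_X]
  rw [punct, punct, Scheme.Hom.preimage_iSup]
  simp only [this]

lemma punct_compact (B : Type) [CommRing B] :
    IsCompact (punct B : Set (SR (MvPolynomial (Fin 2) B))) := by
  rw [punct, TopologicalSpace.Opens.coe_iSup]
  exact isCompact_iUnion fun i => PrimeSpectrum.isCompact_basicOpen _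

section
variable {k : Type} [Field k] (A : Subring k)

/-- index category -/
abbrev FGS : Type := {B : Subalgebra A k // B.FG}

instance : IsDirectedOrder (FGS A) :=
  ⟨fun B C => ⟨⟨B.1 ⊔ C.1, B.2.sup C.2⟩, (le_sup_left : B.1 ≤ _), (le_sup_right : C.1 ≤ _)⟩⟩

instance : Nonempty (FGS A) := ⟨⟨⊥, Subalgebra.fg_bot⟩⟩

/-- the diagram of polynomial rings -/
def FGD : FGS A ⥤ CommRingCat.{0} where
  obj B := .of (MvPolynomial (Fin 2) B.1)
  map {B C} h := CommRingCat.ofHom (MvPolynomial.map (Subalgebra.inclusion h.le).toRingHom)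
  map_id B := by
    ext x
    · simp
    · simp
  map_comp f g := by
    ext x
    · simp
    · simp

/-- the cocone -/
def FGC : Cocone (FGD A) where
  pt := .of (MvPolynomial (Fin 2) k)
  ι := { app B := CommRingCat.ofHom (MvPolynomial.map B.1.val.toRingHom)
         naturality B C h := by
          apply CommRingCat.hom_ext
          apply MvPolynomial.ringHom_ext
          · intro x
            simp [FGD]
          · intro x
            simp [FGD] }

/-- it is a colimit -/
def FGC_isColimit : IsColimit (FGC A) := by
  have : ReflectsColimitsOfShape (FGS A) (forget CommRingCat.{0}) :=
    reflectsColimitsOfShape_of_reflectsIsomorphisms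
  apply isColimitOfReflects (forget CommRingCat.{0})
  apply Types.FilteredColimit.isColimitOf'
  · intro (x : MvPolynomial (Fin 2) k)
    let B : FGS A := ⟨Algebra.adjoin A (x.coeffs : Set k), ⟨x.coeffs, rfl⟩⟩
    have : x ∈ Set.range (MvPolynomial.map (σ := Fin 2) B.1.val.toRingHom) := by
      rw [MvPolynomial.mem_range_map_iff_coeffs_subset]
      intro y hy
      exact ⟨⟨y, Algebra.subset_adjoin hy⟩, rfl⟩
    obtain ⟨y, hy⟩ := this
    exact ⟨B, y, hy.symm⟩
  · intro B x y h
    refine ⟨B, 𝟙 _, ?_⟩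
    have : x = y := MvPolynomial.map_injective _ Subtype.val_injective h
    rw [this]

lemma spread {M : Scheme.{0}} (str : M ⟶ SR A) [LocallyOfFinitePresentation str]
    (a : (punct k).toScheme ⟶ M)
    (ha : a ≫ str = (punct k).ι ≫ Spec.map (CommRingCat.ofHom
      (MvPolynomial.C.comp A.subtype))) :
    ∃ (B : Subalgebra A k) (_ : B.FG) (g : (punct B).toScheme ⟶ M)
      (r : (punct k).toScheme ⟶ (punct B).toScheme),
      r ≫ (punct B).ι = (punct k).ι ≫ pmap B.val.toRingHom ∧
      r ≫ g = a ∧ g ≫ str = (punct B).ι ≫ Spec.map (CommRingCat.ofHom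
        (MvPolynomial.C.comp (algebraMap A B))) := by
  let D : (FGS A)ᵒᵖ ⥤ Scheme.{0} := (FGD A).op ⋙ Scheme.Spec
  let c : Cone D := Scheme.Spec.mapCone (FGC A).op
  have hc : IsLimit c := isLimitOfPreserves Scheme.Spec (FGC_isColimit A).op
  let t : D ⟶ (Functor.const _).obj (SR A) :=
    { app B := Spec.map (CommRingCat.ofHom (MvPolynomial.C.comp (algebraMap A B.unop.1)))
      naturality B C h := by
        refine ((Spec.map_comp _ _).symm.trans (congrArg Spec.map ?_)).trans
          (Category.comp_id _).symm
        ext x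
        exact MvPolynomial.map_C _ _ }
  have h1 (B) : CompactSpace (D.obj B) := inferInstanceAs (CompactSpace (Spec _))
  have h2 (B) : QuasiSeparatedSpace (D.obj B) := inferInstanceAs (QuasiSeparatedSpace (Spec _))
  have h3 {i j} (f : i ⟶ j) : IsAffineHom (D.map f) := inferInstanceAs (IsAffineHom (Spec.map _))
  let i : (FGS A)ᵒᵖ := .op ⟨⊥, Subalgebra.fg_bot⟩
  obtain ⟨j, g, r, hr, hrg, hg⟩ := spread_opens' D t str c hc i
    (fun j => punct j.unop.1) (punct_compact _) (fun j φ => punct_preimage _)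
    (punct k) (punct_preimage _) a (by
      refine ha.trans (congrArg (fun z => (punct k).ι ≫ z) ?_)
      refine Eq.trans ?_ (Spec.map_comp _ _)
      congr 1
      refine CommRingCat.hom_ext (RingHom.ext fun x => ?_)
      exact (MvPolynomial.map_C (σ := Fin 2) (⊥ : Subalgebra A k).val.toRingHom
        (algebraMap A (⊥ : Subalgebra A k) x)).symm)
  exact ⟨j.unop.1, j.unop.2, g, r, hr, hrg, hg⟩

end


/-- functoriality of the punctured plane -/
lemma exists_punct_map {B B' : Type} [CommRing B] [CommRing B'] (g : B →+* B') :
    ∃ s : (punct B').toScheme ⟶ (punct B).toScheme,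
      s ≫ (punct B).ι = (punct B').ι ≫ pmap g :=
  ⟨Scheme.Hom.resLE (pmap g) (punct B) (punct B') (punct_preimage g).ge,
    Scheme.Hom.resLE_comp_ι _ _⟩

lemma pmap_comp {B B' B₂ : Type} [CommRing B] [CommRing B'] [CommRing B₂]
    (g : B →+* B') (h : B' →+* B₂) : pmap h ≫ pmap g = pmap (h.comp g) := by
  refine (Spec.map_comp _ _).symm.trans (congrArg Spec.map ?_)
  refine CommRingCat.hom_ext (RingHom.ext fun x => ?_)
  exact MvPolynomial.map_map g h x

lemma pmap_C {B B' : Type} [CommRing B] [CommRing B'] (A : Type) [CommRing A]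
    (g : B →+* B') (u : A →+* B) :
    pmap g ≫ Spec.map (CommRingCat.ofHom (MvPolynomial.C.comp u)) =
      Spec.map (CommRingCat.ofHom (MvPolynomial.C.comp (g.comp u))) := by
  refine (Spec.map_comp _ _).symm.trans (congrArg Spec.map ?_)
  refine CommRingCat.hom_ext (RingHom.ext fun x => ?_)
  exact MvPolynomial.map_C g (u x)

lemma mem_punct {B : Type} [CommRing B] (x : SR (MvPolynomial (Fin 2) B)) :
    x ∈ punct B ↔ ∃ i : Fin 2, (MvPolynomial.X i : MvPolynomial (Fin 2) B) ∉ x.asIdeal := by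
  rw [punct, TopologicalSpace.Opens.mem_iSup]
  rfl

lemma punct_dense (B : Type) [CommRing B] [IsDomain B] :
    Dense (punct B : Set (SR (MvPolynomial (Fin 2) B))) := by
  have : IrreducibleSpace (SR (MvPolynomial (Fin 2) B)) :=
    inferInstanceAs (IrreducibleSpace (PrimeSpectrum (MvPolynomial (Fin 2) B)))
  refine (punct B).2.dense ⟨(⟨⊥, Ideal.isPrime_bot⟩ : PrimeSpectrum _), ?_⟩
  refine (mem_punct _).2 ⟨0, ?_⟩
  intro h
  exact MvPolynomial.X_ne_zero (R := B) (0 : Fin 2) (Ideal.mem_bot.1 h)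

lemma punct_codim (B : Type) [CommRing B] [IsDomain B] :
    CodimAtLeastTwo ((punct B : Set (SR (MvPolynomial (Fin 2) B)))ᶜ) := by
  intro z hz
  have hz' : ∀ i : Fin 2, (MvPolynomial.X i : MvPolynomial (Fin 2) B) ∈ z.asIdeal := by
    intro i
    by_contra h
    exact hz ((mem_punct _).2 ⟨i, h⟩)
  have hp : (Ideal.span {(MvPolynomial.X 0 : MvPolynomial (Fin 2) B)}).IsPrime :=
    (Ideal.span_singleton_prime (MvPolynomial.X_ne_zero _)).2 MvPolynomial.X_prime
  let x : PrimeSpectrum (MvPolynomial (Fin 2) B) := ⟨⊥, Ideal.isPrime_bot⟩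
  let y : PrimeSpectrum (MvPolynomial (Fin 2) B) := ⟨_, hp⟩
  refine ⟨x, y, ?_, ?_, ?_, ?_⟩
  · exact (PrimeSpectrum.le_iff_specializes x y).1 bot_le
  · refine (PrimeSpectrum.le_iff_specializes y z).1 ?_
    exact (Ideal.span_singleton_le_iff_mem _).2 (hz' 0)
  · intro h
    have h' := (PrimeSpectrum.le_iff_specializes y x).2 h
    have := h' (Ideal.mem_span_singleton_self (MvPolynomial.X 0))
    exact MvPolynomial.X_ne_zero (R := B) (0 : Fin 2) (Ideal.mem_bot.1 this)
  · intro h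
    have h' := (PrimeSpectrum.le_iff_specializes z y).2 h
    have := Ideal.mem_span_singleton.1 (h' (hz' 1))
    rw [MvPolynomial.X_dvd_X] at this
    simp at this

lemma plane_smooth (A B : Type) [CommRing A] [CommRing B] [Algebra A B] [Algebra.Smooth A B] :
    Smooth (Spec.map (CommRingCat.ofHom
      ((MvPolynomial.C (σ := Fin 2)).comp (algebraMap A B)))) := by
  have h : Algebra.Smooth A (MvPolynomial (Fin 2) B) := by
    have : Algebra.Smooth B (MvPolynomial (Fin 2) B) := ⟨inferInstance, inferInstance⟩
    exact Algebra.Smooth.comp A B _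
  rw [HasRingHomProperty.Spec_iff (P := @Smooth)]
  exact RingHom.smooth_algebraMap.2 h

lemma main_thm (k : Type) [Field k] [CharZero k]
    (X : OverR k) (hX : IsSeparated X.hom)
    (hpure : HasArithmeticallyPureModel k X) (f : P1 k ⟶ X) : IsConstant f := by
  obtain ⟨A, hA, ⟨M, str, lft, qc, sep, base, base_w⟩, hp⟩ := hpure
  have hAn : IsNoetherianRing A := Algebra.FiniteType.isNoetherianRing ℤ A
  have hfp : LocallyOfFinitePresentation str := inferInstance
  obtain ⟨π, hπ₁, hπ⟩ := exists_proj k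
  have hinv : base.inv ≫ pullback.snd str (Spec.map (CommRingCat.ofHom A.subtype)) = X.hom := by
    rw [← base_w, Iso.inv_hom_id_assoc]
  have hCA : Spec.map (CommRingCat.ofHom (MvPolynomial.C (σ := Fin 2) (R := k))) ≫ (Spec.map (CommRingCat.ofHom A.subtype)) =
      Spec.map (CommRingCat.ofHom (MvPolynomial.C.comp A.subtype)) :=
    (Spec.map_comp _ _).symm
  have hfX : π ≫ f.left ≫ X.hom = (punct k).ι ≫ Spec.map (CommRingCat.ofHom MvPolynomial.C) := by
    rw [Over.w f, hπ₁]
  obtain ⟨B, hB, g, r, hr, hrg, hg⟩ := spread A str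
    (π ≫ f.left ≫ base.inv ≫ pullback.fst str (Spec.map (CommRingCat.ofHom A.subtype))) (by
      simp only [Category.assoc]
      rw [pullback.condition, reassoc_of% hinv, reassoc_of% hfX, hCA])
  obtain ⟨B', _, _, _, hsm, j, φ, hφ⟩ := exists_smooth_aux A B hB
  obtain ⟨s, hs⟩ := exists_punct_map j.toRingHom
  obtain ⟨r', hr'⟩ := exists_punct_map φ.toRingHom
  have hφj : φ.toRingHom.comp j.toRingHom = B.val.toRingHom :=
    congrArg AlgHom.toRingHom hφ
  have hrs : r' ≫ s = r := by
    rw [← cancel_mono (punct B).ι, Category.assoc, hs, reassoc_of% hr', pmap_comp, hφj, hr]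
  have hj : j.toRingHom.comp (algebraMap A B) = algebraMap A B' := j.comp_algebraMap
  have hφ' : φ.toRingHom.comp (algebraMap A B') = A.subtype := φ.comp_algebraMap
  have hsmT := plane_smooth A B'
  obtain ⟨g', ⟨hg'₁, hg'₂⟩, -⟩ := hp (SR (MvPolynomial (Fin 2) B'))
    (Spec.map (CommRingCat.ofHom (MvPolynomial.C.comp (algebraMap A B'))))
    hsmT inferInstance inferInstance inferInstance inferInstance (punct B') (punct_dense B')
    (punct_codim B') (s ≫ g) (by
      rw [Category.assoc, hg, reassoc_of% hs, pmap_C, hj])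
  dsimp only at g' hg'₁ hg'₂
  have hw : (pmap φ.toRingHom ≫ g') ≫ str =
      Spec.map (CommRingCat.ofHom (MvPolynomial.C (σ := Fin 2) (R := k))) ≫
        (Spec.map (CommRingCat.ofHom A.subtype)) := by
    rw [Category.assoc, hg'₁, pmap_C, hφ', hCA]
  refine lemmaK X hX f π hπ (pullback.lift _ _ hw ≫ base.hom) ?_ ?_
  · rw [Category.assoc, base_w, pullback.lift_snd]
  · rw [← cancel_mono base.inv]
    simp only [Category.assoc, Iso.hom_inv_id, Category.comp_id]
    apply pullback.hom_ext
    · simp only [Category.assoc, pullback.lift_fst]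
      rw [← reassoc_of% hr', hg'₂, reassoc_of% hrs, hrg]
    · simp only [Category.assoc, pullback.lift_snd]
      rw [hinv, hfX]


/-- Let `k` be an algebraically closed field of characteristic zero and
let `X` be a proper variety over `k` that has an arithmetically-pure model. Then `X` has
no rational curves, i.e. every morphism `ℙ¹_k ⟶ X` over `k` is constant. -/
theorem stmt_16 (k : Type) [Field k] [IsAlgClosed k] [CharZero k]
    (X : OverR k) (hX : IsVarietyOver X) (hproper : IsProper X.hom)
    (hpure : HasArithmeticallyPureModel k X) :
    ∀ f : P1 k ⟶ X, IsConstant f := by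
  intro f
  exact main_thm k X hX.2.2 hpure f

end
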